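/- Let X be an atomistic Dacey space of at most countable rank such that C(X) has the covering property, and let A be an orthoclosed subset of X. If D is a maximal ⊥-set contained in A, then the cardinality of D equals the rank of A (where A is regarded as an orthoset with the restricted relation). In particular, any two maximal ⊥-sets in A have the same cardinality. -/

import Mathlib

class Orthoset (X : Type*) extends Zero X where
  perp : X → X → Prop
  perp_comm : ∀ x y : X, perp x y → perp y x
  perp_self : ∀ x : X, perp x x → x = 0
  zero_perp : ∀ x : X, perp 0 x

namespace Orthoset

variable {X : Type*} [Orthoset X]

/-- The orthocomplement of a subset of an orthoset. -/
def ortho (A : Set X) : Set X := {x : X | ∀ y ∈ A, perp x y}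

/-- A subset is orthoclosed if it equals its double orthocomplement. -/
def Orthoclosed (A : Set X) : Prop := ortho (ortho A) = A

/-- `X` is a Dacey space: `C(X)` is orthomodular. -/
def IsDacey (X : Type*) [Orthoset X] : Prop :=
  ∀ A B : Set X, Orthoclosed A → Orthoclosed B → B ⊆ A →
    A = ortho (ortho (B ∪ (A ∩ ortho B)))

/-- `X` is atomistic: for proper `x, y`, `{x}^⊥ ⊆ {y}^⊥` implies `{x}^⊥ = {y}^⊥`. -/
def Atomistic (X : Type*) [Orthoset X] : Prop :=
  ∀ x y : X, x ≠ 0 → y ≠ 0 → ortho ({x} : Set X) ⊆ ortho ({y} : Set X) →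
    ortho ({x} : Set X) = ortho ({y} : Set X)

/-- `P` is an atom of the lattice `C(X)` of orthoclosed subsets. -/
def IsAtomC (X : Type*) [Orthoset X] (P : Set X) : Prop :=
  Orthoclosed P ∧ P ≠ {0} ∧
    ∀ Q : Set X, Orthoclosed Q → Q ⊆ P → Q = {0} ∨ Q = P

/-- `B` covers `A` in the lattice `C(X)` of orthoclosed subsets. -/
def CoversC {X : Type*} [Orthoset X] (A B : Set X) : Prop :=
  A ⊂ B ∧ ∀ C : Set X, Orthoclosed C → A ⊆ C → C ⊆ B → C = A ∨ C = B

/-- The lattice `C(X)` has the covering property. -/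
def CoveringProperty (X : Type*) [Orthoset X] : Prop :=
  ∀ A P : Set X, Orthoclosed A → IsAtomC X P → ¬ P ⊆ A →
    CoversC A (ortho (ortho (A ∪ P)))

/-- A `⊥`-set: a set of mutually orthogonal proper elements. -/
def PerpSet (D : Set X) : Prop :=
  (∀ x ∈ D, x ≠ 0) ∧ ∀ x ∈ D, ∀ y ∈ D, x ≠ y → perp x y

/-- The rank of a subset `A` of an orthoset: the supremum of the cardinalities of the
`⊥`-sets contained in `A`. -/
noncomputable def rankOf (A : Set X) : Cardinal :=
  sSup {c : Cardinal | ∃ D : Set X, PerpSet D ∧ D ⊆ A ∧ c = Cardinal.mk D}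

end Orthoset

open Orthoset

namespace Orthoset

section aux
variable {X : Type*} [Orthoset X]

/-- closure -/
def clo (S : Set X) : Set X := ortho (ortho S)

theorem ortho_anti {S T : Set X} (h : S ⊆ T) : ortho T ⊆ ortho S :=
  fun _ hx y hy => hx y (h hy)

theorem subset_clo (S : Set X) : S ⊆ clo S :=
  fun x hx y hy => perp_comm _ _ (hy x hx)

theorem clo_mono {S T : Set X} (h : S ⊆ T) : clo S ⊆ clo T := ortho_anti (ortho_anti h)

theorem ortho_clo (S : Set X) : ortho (clo S) = ortho S :=
  Set.Subset.antisymm (ortho_anti (subset_clo S)) (subset_clo (ortho S))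

theorem clo_clo (S : Set X) : Orthoclosed (clo S) := by
  show ortho (ortho (clo S)) = clo S
  rw [ortho_clo]; rfl

theorem clo_le {S T : Set X} (h : S ⊆ clo T) : clo S ⊆ clo T := by
  have := clo_mono h
  rwa [show clo (clo T) = clo T from clo_clo T] at this

theorem zero_mem_clo (S : Set X) : (0 : X) ∈ clo S := fun y _ => zero_perp y

theorem atom_clo (hatom : Atomistic X) {x : X} (hx : x ≠ 0) : IsAtomC X (clo {x}) := by
  refine ⟨clo_clo _, ?_, ?_⟩
  · intro h
    have : x ∈ clo ({x} : Set X) := subset_clo _ rfl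
    rw [h] at this
    exact hx this
  · intro Q hQ hQx
    by_cases h0 : ∃ y ∈ Q, y ≠ 0
    · right
      obtain ⟨y, hyQ, hy⟩ := h0
      apply Set.Subset.antisymm hQx
      have h1 : ortho ({x} : Set X) ⊆ ortho ({y} : Set X) := by
        rw [← ortho_clo {x}]
        apply ortho_anti
        simpa using hQx hyQ
      have h2 := hatom x y hx hy h1
      have h3 : clo ({x} : Set X) = clo {y} := by unfold clo; rw [h2]
      rw [h3, ← show clo Q = Q from hQ]
      exact clo_mono (by simpa using hyQ)
    · left
      push Not at h0
      ext z
      constructor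
      · intro hz; exact h0 z hz
      · intro hz
        rw [Set.mem_singleton_iff] at hz
        rw [hz, ← show clo Q = Q from hQ]
        exact zero_mem_clo Q

theorem clo_exchange (hatom : Atomistic X) (hcov : CoveringProperty X) {S : Set X} {x y : X}
    (hy : y ∈ clo (insert x S)) (hyS : y ∉ clo S) : x ∈ clo (insert y S) := by
  by_cases hx : x = 0
  · rw [hx]; exact zero_mem_clo _
  have hxS : x ∉ clo S := fun h =>
    hyS (clo_le (Set.insert_subset h (subset_clo S)) hy)
  have hc := hcov (clo S) (clo {x}) (clo_clo S) (atom_clo hatom hx)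
    (fun h => hxS (h (subset_clo _ rfl)))
  have hxx : insert x S ⊆ clo S ∪ clo {x} :=
    Set.insert_subset (Or.inr (subset_clo _ rfl)) (fun z hz => Or.inl (subset_clo S hz))
  have hle : clo (insert x S) ⊆ clo (clo S ∪ clo {x}) := clo_mono hxx
  rcases hc.2 (clo (insert y S)) (clo_clo _) (clo_mono (Set.subset_insert _ _))
    (clo_le (Set.insert_subset (hle hy)
      (((Set.subset_insert x S).trans hxx).trans (subset_clo _)))) with h | h
  · exact absurd (h ▸ subset_clo (insert y S) (Set.mem_insert y S)) hyS
  · rw [h]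
    exact hle (subset_clo _ (Set.mem_insert x S))

theorem exists_exchange (hatom : Atomistic X) (hcov : CoveringProperty X) (S : Set X) (e : X)
    (he : e ∉ clo S) (F : Finset X) (hF : e ∈ clo (S ∪ F)) :
    ∃ d ∈ F, d ∈ clo (insert e (S ∪ ((F : Set X) \ {d}))) := by
  classical
  induction F using Finset.induction_on with
  | empty => simp at hF; exact absurd hF he
  | insert d F hd ih =>
    by_cases h : e ∈ clo (S ∪ F)
    · obtain ⟨d', hd', h'⟩ := ih h
      refine ⟨d', Finset.mem_insert_of_mem hd', clo_mono ?_ h'⟩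
      apply Set.insert_subset_insert
      apply Set.union_subset_union_right
      apply Set.diff_subset_diff_left
      simp
    · refine ⟨d, Finset.mem_insert_self _ _, ?_⟩
      have hF' : e ∈ clo (insert d (S ∪ (F : Set X))) := by
        rw [Finset.coe_insert, Set.union_insert] at hF
        exact hF
      refine clo_mono ?_ (clo_exchange hatom hcov hF' h)
      apply Set.insert_subset_insert
      apply Set.union_subset_union_right
      intro z hz
      refine ⟨by simp [Finset.mem_coe.1 hz], ?_⟩
      rintro rfl
      exact hd hz

theorem steinitz (hatom : Atomistic X) (hcov : CoveringProperty X) (E : Finset X)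
    (hE : PerpSet (E : Set X)) [DecidableEq X] (n : ℕ) : ∀ D : Finset X, (E \ D).card = n →
      (E : Set X) ⊆ clo D → E.card ≤ D.card := by
  induction n with
  | zero =>
    intro D h _
    exact Finset.card_le_card (Finset.sdiff_eq_empty_iff_subset.1 (Finset.card_eq_zero.1 h))
  | succ n ih =>
    intro D h hED
    obtain ⟨e, he⟩ := Finset.card_pos.1 (by omega : 0 < (E \ D).card)
    obtain ⟨heE, heD⟩ := Finset.mem_sdiff.1 he
    have h1 : e ∉ clo ((D ∩ E : Finset X) : Set X) := by
      intro hc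
      refine hE.1 e heE (perp_self e (hc e ?_))
      intro y hy
      have hy' := Finset.mem_inter.1 (Finset.mem_coe.1 hy)
      exact hE.2 e heE y hy'.2 (fun h => heD (h ▸ hy'.1))
    have h2 : e ∈ clo (((D ∩ E : Finset X) : Set X) ∪ ((D \ E : Finset X) : Set X)) := by
      refine clo_mono ?_ (hED heE)
      intro z hz
      by_cases hzE : z ∈ E
      · left; simpa using ⟨hz, hzE⟩
      · right; simpa using ⟨hz, hzE⟩
    obtain ⟨d, hd, hd'⟩ := exists_exchange hatom hcov _ e h1 _ h2
    obtain ⟨hdD, hdE⟩ := Finset.mem_sdiff.1 hd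
    have h3 : d ∈ clo ((insert e (D.erase d) : Finset X) : Set X) := by
      refine clo_mono ?_ hd'
      rw [Finset.coe_insert]
      apply Set.insert_subset_insert
      rintro z (hz | ⟨hz, hz'⟩)
      · have hz := Finset.mem_inter.1 (Finset.mem_coe.1 hz)
        exact Finset.mem_coe.2 (Finset.mem_erase.2 ⟨fun h => hdE (h ▸ hz.2), hz.1⟩)
      · exact Finset.mem_coe.2 (Finset.mem_erase.2 ⟨hz', (Finset.mem_sdiff.1 hz).1⟩)
    have h4 : (D : Set X) ⊆ clo ((insert e (D.erase d) : Finset X) : Set X) := by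
      intro z hz
      by_cases hzd : z = d
      · rw [hzd]; exact h3
      · exact subset_clo _ (Finset.mem_coe.2
          (Finset.mem_insert_of_mem (Finset.mem_erase.2 ⟨hzd, hz⟩)))
    have h5 : (insert e (D.erase d)).card = D.card := by
      rw [Finset.card_insert_of_notMem (fun h => heD (Finset.mem_of_mem_erase h)),
        Finset.card_erase_add_one hdD]
    rw [← h5]
    refine ih _ ?_ (hED.trans (clo_le h4))
    have h6 : E \ insert e (D.erase d) = (E \ D).erase e := by
      ext z
      simp only [Finset.mem_sdiff, Finset.mem_insert, Finset.mem_erase]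
      constructor
      · rintro ⟨hz, hn⟩
        push Not at hn
        refine ⟨hn.1, hz, fun hzD => hn.2 (fun h => hdE (h ▸ hz)) hzD⟩
      · rintro ⟨hze, hz, hzD⟩
        exact ⟨hz, fun h => h.elim hze (fun h => hzD h.2)⟩
    rw [h6, Finset.card_erase_of_mem he, h]
    rfl

theorem subset_clo_of_max (hdacey : IsDacey X) {A D : Set X} (hA : Orthoclosed A)
    (hD : PerpSet D) (hDA : D ⊆ A)
    (hDmax : ∀ E : Set X, PerpSet E → E ⊆ A → D ⊆ E → E = D) : A ⊆ clo D := by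
  have hBA : clo D ⊆ A := by
    have := clo_mono hDA
    rwa [show clo A = A from hA] at this
  have h := hdacey A (clo D) hA (clo_clo D) hBA
  have h2 : clo D ∪ (A ∩ ortho (clo D)) ⊆ clo D := by
    apply Set.union_subset subset_rfl
    rintro z ⟨hzA, hz⟩
    by_cases hz0 : z = 0
    · rw [hz0]; exact zero_mem_clo D
    rw [ortho_clo] at hz
    have := hDmax (insert z D) ⟨?_, ?_⟩ (Set.insert_subset hzA hDA) (Set.subset_insert _ _)
    · exact subset_clo D (this ▸ Set.mem_insert z D)
    · rintro x (rfl | hx)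
      · exact hz0
      · exact hD.1 x hx
    · rintro x (rfl | hx) y (rfl | hy) hxy
      · exact absurd rfl hxy
      · exact hz y hy
      · exact perp_comm _ _ (hz x hx)
      · exact hD.2 x hx y hy hxy
  rw [h]
  exact clo_le h2

theorem card_le_of_max (hatom : Atomistic X) (hdacey : IsDacey X) (hcov : CoveringProperty X)
    (hcount : ∀ D : Set X, PerpSet D → Cardinal.mk D ≤ Cardinal.aleph0)
    {A : Set X} (hA : Orthoclosed A) {D : Set X} (hD : PerpSet D) (hDA : D ⊆ A)
    (hDmax : ∀ E : Set X, PerpSet E → E ⊆ A → D ⊆ E → E = D)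
    {E : Set X} (hE : PerpSet E) (hEA : E ⊆ A) : Cardinal.mk E ≤ Cardinal.mk D := by
  classical
  by_cases hfin : D.Finite
  · lift D to Finset X using hfin
    have hspan := subset_clo_of_max hdacey hA hD hDA hDmax
    rw [show Cardinal.mk (D : Set X) = (D.card : Cardinal) from Cardinal.mk_coe_finset]
    apply Cardinal.card_le_of
    intro s
    have hs : ((s.map (Function.Embedding.subtype _) : Finset X) : Set X) ⊆ E := by
      intro z hz
      obtain ⟨w, _, rfl⟩ := Finset.mem_map.1 (Finset.mem_coe.1 hz)
      exact w.2
    rw [← Finset.card_map (Function.Embedding.subtype _)]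
    exact steinitz hatom hcov _ ⟨fun x hx => hE.1 x (hs hx),
      fun x hx y hy => hE.2 x (hs hx) y (hs hy)⟩ _ D rfl ((hs.trans hEA).trans hspan)
  · have : Infinite D := Set.infinite_coe_iff.2 hfin
    exact (hcount E hE).trans (Cardinal.aleph0_le_mk D)

end aux

end Orthoset

/-- Let `X` be an atomistic Dacey space of at most countable rank such that `C(X)` has the
covering property, and let `A` be orthoclosed. If `D` is a maximal `⊥`-set contained in `A`,
then the cardinality of `D` equals the rank of `A`; in particular, any two maximal `⊥`-sets
in `A` have the same cardinality. -/
theorem stmt5 {X : Type*} [Orthoset X]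
    (hatom : Atomistic X) (hdacey : IsDacey X) (hcov : CoveringProperty X)
    (hcount : ∀ D : Set X, PerpSet D → Cardinal.mk D ≤ Cardinal.aleph0)
    (A : Set X) (hA : Orthoclosed A)
    (D : Set X) (hD : PerpSet D) (hDA : D ⊆ A)
    (hDmax : ∀ E : Set X, PerpSet E → E ⊆ A → D ⊆ E → E = D) :
    Cardinal.mk D = rankOf A ∧
      ∀ E : Set X, PerpSet E → E ⊆ A →
        (∀ E' : Set X, PerpSet E' → E' ⊆ A → E ⊆ E' → E' = E) →
        Cardinal.mk E = Cardinal.mk D := by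
  have key : ∀ E : Set X, PerpSet E → E ⊆ A → Cardinal.mk E ≤ Cardinal.mk D :=
    fun E hE hEA => card_le_of_max hatom hdacey hcov hcount hA hD hDA hDmax hE hEA
  refine ⟨?_, ?_⟩
  · apply le_antisymm
    · refine le_csSup ⟨Cardinal.mk D, ?_⟩ ⟨D, hD, hDA, rfl⟩
      rintro c ⟨E, hE, hEA, rfl⟩
      exact key E hE hEA
    · apply csSup_le'
      rintro c ⟨E, hE, hEA, rfl⟩
      exact key E hE hEA
  · intro E hE hEA hEmax
    exact le_antisymm (key E hE hEA)
      (card_le_of_max hatom hdacey hcov hcount hA hE hEA hEmax hD hDA)
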